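/- Let Γ̄ ∈ MCS_χ and X := { Δ̄ ∈ MCS_χ | Γ̄ R_○ Δ̄ }. Then ⊢_CS (⋀Γ̄) → ○⋁{ ⋀Δ̄ | Δ̄ ∈ X }, where ⋀Γ̄ is the conjunction of all elements of Γ̄ and ⋁ is the disjunction over the finite set of such conjunctions. -/

import Mathlib

namespace TJL

/-- Justification terms: constants, variables, !t, t+t, t·t. -/
inductive JTerm : Type
  | const : ℕ → JTerm
  | var : ℕ → JTerm
  | bang : JTerm → JTerm
  | plus : JTerm → JTerm → JTerm
  | app : JTerm → JTerm → JTerm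

/-- Formulas of LPLTL^P with `h` agents. -/
inductive Formula (h : ℕ) : Type
  | atom : ℕ → Formula h
  | bot : Formula h
  | imp : Formula h → Formula h → Formula h
  | next : Formula h → Formula h
  | wprev : Formula h → Formula h
  | funtil : Formula h → Formula h → Formula h
  | fsince : Formula h → Formula h → Formula h
  | jbox : JTerm → Fin h → Formula h → Formula h

namespace Formula

variable {h : ℕ}

def neg (φ : Formula h) : Formula h := φ.imp .bot
def top : Formula h := neg .bot
def sprev (φ : Formula h) : Formula h := neg (wprev (neg φ))
def ev (φ : Formula h) : Formula h := funtil top φ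
def always (φ : Formula h) : Formula h := neg (ev (neg φ))
def once (φ : Formula h) : Formula h := fsince top φ
def halways (φ : Formula h) : Formula h := neg (once (neg φ))
def or' (φ ψ : Formula h) : Formula h := (neg φ).imp ψ
def and' (φ ψ : Formula h) : Formula h := neg (or' (neg φ) (neg ψ))
def iff' (φ ψ : Formula h) : Formula h := and' (φ.imp ψ) (ψ.imp φ)

end Formula

open Formula

/-- A boolean valuation respecting ⊥ and →. -/
def IsPropEval {h : ℕ} (v : Formula h → Bool) : Prop :=
  v .bot = false ∧ ∀ φ ψ : Formula h, v (φ.imp ψ) = (!(v φ) || v ψ)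

/-- Propositional tautologies. -/
def Tautology {h : ℕ} (φ : Formula h) : Prop :=
  ∀ v : Formula h → Bool, IsPropEval v → v φ = true

/-- The axioms of LPLTL^P. -/
inductive Ax {h : ℕ} : Formula h → Prop
  | taut (φ : Formula h) : Tautology φ → Ax φ
  | nextK (φ ψ : Formula h) : Ax ((Formula.next (φ.imp ψ)).imp ((Formula.next φ).imp (Formula.next ψ)))
  | boxK (φ ψ : Formula h) : Ax ((always (φ.imp ψ)).imp ((always φ).imp (always ψ)))
  | func (φ : Formula h) : Ax (iff' (Formula.next (neg φ)) (neg (Formula.next φ)))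
  | ind (φ : Formula h) : Ax ((always (φ.imp (Formula.next φ))).imp (φ.imp (always φ)))
  | until1 (φ ψ : Formula h) : Ax ((Formula.funtil φ ψ).imp (ev ψ))
  | until2 (φ ψ : Formula h) :
      Ax (iff' (Formula.funtil φ ψ) (or' ψ (and' φ (Formula.next (Formula.funtil φ ψ)))))
  | hboxK (φ ψ : Formula h) : Ax ((halways (φ.imp ψ)).imp ((halways φ).imp (halways ψ)))
  | wprevK (φ ψ : Formula h) :
      Ax ((Formula.wprev (φ.imp ψ)).imp ((Formula.wprev φ).imp (Formula.wprev ψ)))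
  | sw (φ : Formula h) : Ax ((sprev φ).imp (Formula.wprev φ))
  | fp (φ : Formula h) : Ax (φ.imp (Formula.next (sprev φ)))
  | pf (φ : Formula h) : Ax (φ.imp (Formula.wprev (Formula.next φ)))
  | initial : Ax (once (Formula.wprev (.bot : Formula h)))
  | hind (φ : Formula h) : Ax ((halways (φ.imp (Formula.wprev φ))).imp (φ.imp (halways φ)))
  | since1 (φ ψ : Formula h) : Ax ((Formula.fsince φ ψ).imp (once ψ))
  | since2 (φ ψ : Formula h) :
      Ax (iff' (Formula.fsince φ ψ) (or' ψ (and' φ (sprev (Formula.fsince φ ψ)))))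
  | japp (t s : JTerm) (i : Fin h) (φ ψ : Formula h) :
      Ax ((Formula.jbox t i (φ.imp ψ)).imp ((Formula.jbox s i φ).imp (Formula.jbox (.app t s) i ψ)))
  | jsum1 (t s : JTerm) (i : Fin h) (φ : Formula h) :
      Ax ((Formula.jbox t i φ).imp (Formula.jbox (.plus t s) i φ))
  | jsum2 (t s : JTerm) (i : Fin h) (φ : Formula h) :
      Ax ((Formula.jbox s i φ).imp (Formula.jbox (.plus t s) i φ))
  | jrefl (t : JTerm) (i : Fin h) (φ : Formula h) : Ax ((Formula.jbox t i φ).imp φ)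
  | jpos (t : JTerm) (i : Fin h) (φ : Formula h) :
      Ax ((Formula.jbox t i φ).imp (Formula.jbox (.bang t) i (Formula.jbox t i φ)))

/-- Formulas of the shape [c_n]_{i_n}⋯[c_1]_{i_1}φ with n ≥ 1 and φ an axiom instance. -/
inductive CSForm {h : ℕ} : Formula h → Prop
  | base (c : ℕ) (i : Fin h) (φ : Formula h) : Ax φ → CSForm (.jbox (.const c) i φ)
  | step (c : ℕ) (i : Fin h) (φ : Formula h) : CSForm φ → CSForm (.jbox (.const c) i φ)

/-- Downward-closed constant specifications. -/
def IsConstSpec {h : ℕ} (CS : Set (Formula h)) : Prop :=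
  (∀ φ ∈ CS, CSForm φ) ∧
  (∀ (c : ℕ) (i : Fin h) (φ : Formula h),
    Formula.jbox (.const c) i φ ∈ CS → CSForm φ → φ ∈ CS)

/-- Derivability in LPLTL^P_CS. -/
inductive Deriv {h : ℕ} (CS : Set (Formula h)) : Formula h → Prop
  | ax {φ : Formula h} : Ax φ → Deriv CS φ
  | cs {φ : Formula h} : φ ∈ CS → Deriv CS φ
  | mp {φ ψ : Formula h} : Deriv CS (φ.imp ψ) → Deriv CS φ → Deriv CS ψ
  | necNext {φ : Formula h} : Deriv CS φ → Deriv CS (.next φ)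
  | necWprev {φ : Formula h} : Deriv CS φ → Deriv CS (.wprev φ)
  | necBox {φ : Formula h} : Deriv CS φ → Deriv CS (always φ)
  | necHbox {φ : Formula h} : Deriv CS φ → Deriv CS (halways φ)

def conjList {h : ℕ} : List (Formula h) → Formula h
  | [] => top
  | φ :: l => and' φ (conjList l)

def disjList {h : ℕ} : List (Formula h) → Formula h
  | [] => .bot
  | φ :: l => or' φ (disjList l)

/-- Γ ⊢_CS φ : derivability from assumptions. -/
def DerivFrom {h : ℕ} (CS : Set (Formula h)) (Γ : Set (Formula h)) (φ : Formula h) : Prop :=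
  ∃ L : List (Formula h), (∀ ψ ∈ L, ψ ∈ Γ) ∧ Deriv CS ((conjList L).imp φ)

/-- CS-consistency. -/
def Consistent {h : ℕ} (CS : Set (Formula h)) (Γ : Set (Formula h)) : Prop :=
  ¬ DerivFrom CS Γ .bot

/-- Maximal CS-consistent sets. -/
def MaxCons {h : ℕ} (CS : Set (Formula h)) (Γ : Set (Formula h)) : Prop :=
  Consistent CS Γ ∧ ∀ Δ, Γ ⊆ Δ → Consistent CS Δ → Δ = Γ

/-- Subformulas. -/
def Subf {h : ℕ} : Formula h → Set (Formula h)
  | .atom P => {.atom P}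
  | .bot => {.bot}
  | .imp φ ψ => insert (.imp φ ψ) (Subf φ ∪ Subf ψ)
  | .next φ => insert (.next φ) (Subf φ)
  | .wprev φ => insert (.wprev φ) (Subf φ)
  | .funtil φ ψ => insert (.funtil φ ψ) (Subf φ ∪ Subf ψ)
  | .fsince φ ψ => insert (.fsince φ ψ) (Subf φ ∪ Subf ψ)
  | .jbox t i φ => insert (.jbox t i φ) (Subf φ)

/-- A_χ := Sub(χ) ∪ Sub(⊤ S Ⓦ⊥). -/
def Achi {h : ℕ} (χ : Formula h) : Set (Formula h) :=
  Subf χ ∪ Subf (Formula.fsince top (Formula.wprev .bot))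

/-- Sub⁺(χ) := A_χ ∪ {¬ψ | ψ ∈ A_χ}. -/
def SubPlus {h : ℕ} (χ : Formula h) : Set (Formula h) :=
  Achi χ ∪ (neg '' Achi χ)

/-- MCS_χ : the χ-maximal CS-consistent subsets of Sub⁺(χ). -/
def ChiMCS {h : ℕ} (CS : Set (Formula h)) (χ : Formula h) : Set (Set (Formula h)) :=
  {Γb | Γb ⊆ SubPlus χ ∧ Consistent CS Γb ∧
    ∀ Δ, Γb ⊆ Δ → Δ ⊆ SubPlus χ → Consistent CS Δ → Δ = Γb}

/-- The relation R_○ on MCS_χ, via representatives Γ, Δ ∈ MCS: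
    Γ̄ R_○ Δ̄ iff {○φ | φ ∈ Δ} ⊆ Γ. -/
def RNext {h : ℕ} (CS : Set (Formula h)) (χ : Formula h) (Γb Δb : Set (Formula h)) : Prop :=
  ∃ Γ Δ : Set (Formula h), MaxCons CS Γ ∧ MaxCons CS Δ ∧
    Γb = Γ ∩ SubPlus χ ∧ Δb = Δ ∩ SubPlus χ ∧
    ∀ φ ∈ Δ, Formula.next φ ∈ Γ

/-- γ is a conjunction of all elements of the finite set S (in some order). -/
def IsConj {h : ℕ} (S : Set (Formula h)) (γ : Formula h) : Prop :=
  ∃ L : List (Formula h), L.Nodup ∧ (∀ ψ, ψ ∈ L ↔ ψ ∈ S) ∧ γ = conjList L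

/-- Acceptable sequences of elements of MCS_χ. -/
def Acceptable {h : ℕ} (CS : Set (Formula h)) (χ : Formula h)
    (f : ℕ → Set (Formula h)) : Prop :=
  (∀ n, f n ∈ ChiMCS CS χ) ∧
  (∀ n, RNext CS χ (f n) (f (n + 1))) ∧
  (∀ n (φ ψ : Formula h), Formula.funtil φ ψ ∈ f n →
    ∃ m, n ≤ m ∧ ψ ∈ f m ∧ ∀ k, n ≤ k → k < m → φ ∈ f k) ∧
  Formula.wprev .bot ∈ f 0

end TJL

namespace TJL

open Formula

variable {h : ℕ} {CS Γ Δ : Set (Formula h)} {φ ψ : Formula h}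

namespace IsPropEval

variable {v : Formula h → Bool}

theorem imp_iff (hv : IsPropEval v) (φ ψ : Formula h) :
    v (φ.imp ψ) = true ↔ (v φ = true → v ψ = true) := by
  rw [hv.2]; cases v φ <;> cases v ψ <;> simp

theorem bot_iff (hv : IsPropEval v) : v .bot = true ↔ False := by simp [hv.1]

theorem neg_iff (hv : IsPropEval v) (φ : Formula h) : v (neg φ) = true ↔ ¬ v φ = true := by
  rw [neg, hv.imp_iff, hv.bot_iff]

theorem or_iff (hv : IsPropEval v) (φ ψ : Formula h) :
    v (or' φ ψ) = true ↔ v φ = true ∨ v ψ = true := by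
  rw [or', hv.imp_iff, hv.neg_iff, or_iff_not_imp_left]

theorem and_iff (hv : IsPropEval v) (φ ψ : Formula h) :
    v (and' φ ψ) = true ↔ v φ = true ∧ v ψ = true := by
  rw [and', hv.neg_iff, hv.or_iff, hv.neg_iff, hv.neg_iff]; tauto

theorem conjList_iff (hv : IsPropEval v) (L : List (Formula h)) :
    v (conjList L) = true ↔ ∀ ψ ∈ L, v ψ = true := by
  induction L with
  | nil => simp [conjList, top, hv.neg_iff, hv.bot_iff]
  | cons a L ih => rw [conjList, hv.and_iff, ih, List.forall_mem_cons]

theorem disjList_iff (hv : IsPropEval v) (L : List (Formula h)) :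
    v (disjList L) = true ↔ ∃ ψ ∈ L, v ψ = true := by
  induction L with
  | nil => simp [disjList, hv.bot_iff]
  | cons a L ih => rw [disjList, hv.or_iff, ih, List.exists_mem_cons_iff]

end IsPropEval

/-- Derivability is closed under propositional consequence from one premise. -/
theorem Deriv.of_entails (hφ : Deriv CS φ)
    (H : ∀ v, IsPropEval v → v φ = true → v ψ = true) : Deriv CS ψ :=
  .mp (.ax (.taut _ fun v hv => (hv.imp_iff _ _).2 (H v hv))) hφ

/-- Derivability is closed under propositional consequence from two premises. -/
theorem Deriv.of_entails₂ {θ : Formula h} (hφ : Deriv CS φ) (hψ : Deriv CS ψ)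
    (H : ∀ v, IsPropEval v → v φ = true → v ψ = true → v θ = true) : Deriv CS θ :=
  .mp (hφ.of_entails fun v hv h₁ => (hv.imp_iff _ _).2 (H v hv h₁)) hψ

theorem Deriv.next_of_conjList {L : List (Formula h)} (H : Deriv CS ((conjList L).imp φ)) :
    Deriv CS ((conjList (L.map .next)).imp (.next φ)) := by
  induction L generalizing φ with
  | nil =>
    have hφ : Deriv CS φ := H.of_entails fun v hv h₁ =>
      (hv.imp_iff _ _).1 h₁ ((hv.conjList_iff []).2 (by simp))
    exact hφ.necNext.of_entails fun v hv h₁ => (hv.imp_iff _ _).2 fun _ => h₁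
  | cons a L ih =>
    have H' : Deriv CS ((conjList L).imp (a.imp φ)) := H.of_entails fun v hv h₁ => by
      simp only [conjList, hv.imp_iff, hv.and_iff] at h₁ ⊢
      exact fun hL ha => h₁ ⟨ha, hL⟩
    refine (ih H').of_entails₂ (.ax (.nextK a φ)) fun v hv h₁ h₂ => ?_
    simp only [List.map_cons, conjList, hv.imp_iff, hv.and_iff] at h₁ h₂ ⊢
    exact fun ⟨ha, hL⟩ => h₂ (h₁ hL) ha

namespace DerivFrom

theorem of_deriv (H : Deriv CS φ) : DerivFrom CS Γ φ :=
  ⟨[], by simp, H.of_entails fun _ hv h₁ => (hv.imp_iff _ _).2 fun _ => h₁⟩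

theorem of_mem (H : φ ∈ Γ) : DerivFrom CS Γ φ :=
  ⟨[φ], by simpa using H, .ax (.taut _ fun v hv => by simp [hv.imp_iff, hv.conjList_iff])⟩

theorem mono (hΓ : Γ ⊆ Δ) (H : DerivFrom CS Γ φ) : DerivFrom CS Δ φ :=
  let ⟨L, hL, hd⟩ := H
  ⟨L, fun ψ hψ => hΓ (hL ψ hψ), hd⟩

theorem mp (H₁ : DerivFrom CS Γ (φ.imp ψ)) (H₂ : DerivFrom CS Γ φ) : DerivFrom CS Γ ψ := by
  obtain ⟨L₁, hL₁, hd₁⟩ := H₁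
  obtain ⟨L₂, hL₂, hd₂⟩ := H₂
  refine ⟨L₁ ++ L₂, fun ψ hψ => (List.mem_append.1 hψ).elim (hL₁ ψ) (hL₂ ψ),
    hd₁.of_entails₂ hd₂ fun v hv h₁ h₂ => ?_⟩
  simp only [hv.imp_iff, hv.conjList_iff, List.mem_append] at h₁ h₂ ⊢
  exact fun hL => h₁ (fun ψ hψ => hL ψ (.inl hψ)) (h₂ fun ψ hψ => hL ψ (.inr hψ))

/-- The deduction theorem. -/
theorem imp_of_insert (H : DerivFrom CS (insert φ Γ) ψ) : DerivFrom CS Γ (φ.imp ψ) := by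
  classical
  obtain ⟨L, hL, hd⟩ := H
  refine ⟨L.filter (· ≠ φ), fun θ hθ => ?_, hd.of_entails fun v hv h₁ => ?_⟩
  · obtain ⟨hθL, hne⟩ := List.mem_filter.1 hθ
    exact (hL θ hθL).resolve_left (by simpa using hne)
  · simp only [hv.imp_iff, hv.conjList_iff, List.mem_filter] at h₁ ⊢
    intro hL' hφ
    refine h₁ fun θ hθ => ?_
    by_cases hne : θ = φ
    · rwa [hne]
    · exact hL' θ ⟨hθ, by simpa using hne⟩

end DerivFrom

theorem Consistent.mono (hΓ : Γ ⊆ Δ) (H : Consistent CS Δ) : Consistent CS Γ :=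
  fun hd => H (hd.mono hΓ)

theorem Consistent.not_mem_of_neg_mem (H : Consistent CS Γ) (hφ : neg φ ∈ Γ) : φ ∉ Γ :=
  fun hmem => H (DerivFrom.mp (.of_mem hφ) (.of_mem hmem))

/-- The Lindenbaum lemma. -/
theorem Consistent.exists_maxCons (H : Consistent CS Γ) : ∃ Δ, Γ ⊆ Δ ∧ MaxCons CS Δ := by
  obtain ⟨M, hΓM, hM⟩ := zorn_subset_nonempty {Δ : Set (Formula h) | Consistent CS Δ} (by
    intro c hc hchain hne
    refine ⟨⋃₀ c, ?_, fun s hs => Set.subset_sUnion_of_mem hs⟩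
    rintro ⟨L, hL, hd⟩
    obtain ⟨s, hs, hLs⟩ : ∃ s ∈ c, ∀ ψ ∈ L, ψ ∈ s := by
      clear hd
      induction L with
      | nil => exact hne.imp fun s hs => ⟨hs, by simp⟩
      | cons a L ih =>
        rw [List.forall_mem_cons] at hL
        obtain ⟨s, hs, hLs⟩ := ih hL.2
        obtain ⟨t, ht, hat⟩ := hL.1
        rcases hchain.total hs ht with hst | hts
        · exact ⟨t, ht, List.forall_mem_cons.2 ⟨hat, fun ψ hψ => hst (hLs ψ hψ)⟩⟩
        · exact ⟨s, hs, List.forall_mem_cons.2 ⟨hts hat, hLs⟩⟩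
    exact hc hs ⟨L, hLs, hd⟩) Γ H
  exact ⟨M, hΓM, hM.prop, fun Δ hMΔ hΔ => (hM.eq_of_subset hΔ hMΔ).symm⟩

namespace MaxCons

theorem mem_of_derivFrom (hΓ : MaxCons CS Γ) (H : DerivFrom CS Γ φ) : φ ∈ Γ := by
  rw [← hΓ.2 (insert φ Γ) (Set.subset_insert _ _) fun hd => hΓ.1 (hd.imp_of_insert.mp H)]
  exact Set.mem_insert _ _

theorem mem_of_deriv (hΓ : MaxCons CS Γ) (H : Deriv CS φ) : φ ∈ Γ :=
  hΓ.mem_of_derivFrom (.of_deriv H)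

theorem mem_of_imp_mem (hΓ : MaxCons CS Γ) (H : φ.imp ψ ∈ Γ) (hφ : φ ∈ Γ) : ψ ∈ Γ :=
  hΓ.mem_of_derivFrom (.mp (.of_mem H) (.of_mem hφ))

theorem neg_mem_iff (hΓ : MaxCons CS Γ) : neg φ ∈ Γ ↔ φ ∉ Γ := by
  refine ⟨hΓ.1.not_mem_of_neg_mem, fun hφ => ?_⟩
  by_contra hneg
  have hcons : Consistent CS (insert φ Γ) := fun hd =>
    hneg (hΓ.mem_of_derivFrom hd.imp_of_insert)
  exact hφ (hΓ.2 _ (Set.subset_insert _ _) hcons ▸ Set.mem_insert _ _)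

theorem next_neg_mem_iff (hΓ : MaxCons CS Γ) : Formula.next (neg φ) ∈ Γ ↔ Formula.next φ ∉ Γ := by
  have hax : Deriv CS (iff' (Formula.next (neg φ)) (neg (Formula.next φ))) := .ax (.func φ)
  rw [← hΓ.neg_mem_iff]
  constructor
  · exact hΓ.mem_of_imp_mem (hΓ.mem_of_deriv (hax.of_entails fun v hv h₁ =>
      ((hv.and_iff _ _).1 h₁).1))
  · exact hΓ.mem_of_imp_mem (hΓ.mem_of_deriv (hax.of_entails fun v hv h₁ =>
      ((hv.and_iff _ _).1 h₁).2))

theorem next_mem_of_derivFrom (hΓ : MaxCons CS Γ)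
    (H : DerivFrom CS {ψ | Formula.next ψ ∈ Γ} φ) : Formula.next φ ∈ Γ := by
  obtain ⟨L, hL, hd⟩ := H
  exact hΓ.mem_of_derivFrom ⟨L.map .next, by simpa using hL, hd.next_of_conjList⟩

/-- The formulas true at the next instant of a maximal consistent set form such a set. -/
theorem setOf_next_mem (hΓ : MaxCons CS Γ) : MaxCons CS {ψ | Formula.next ψ ∈ Γ} := by
  refine ⟨fun hd => ?_, fun E hE hcons => (hE.antisymm fun ψ hψ => ?_).symm⟩
  · have htop : Deriv CS (Formula.next (neg (.bot : Formula h))) :=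
      .necNext (.ax (.taut _ fun v hv => by simp [hv.neg_iff, hv.bot_iff]))
    exact hΓ.next_neg_mem_iff.1 (hΓ.mem_of_deriv htop) (hΓ.next_mem_of_derivFrom hd)
  · by_contra hnot
    exact hcons.not_mem_of_neg_mem (hE (hΓ.next_neg_mem_iff.2 hnot)) hψ

theorem inter_subPlus_mem_chiMCS (hΓ : MaxCons CS Γ) (χ : Formula h) :
    Γ ∩ SubPlus χ ∈ ChiMCS CS χ := by
  refine ⟨Set.inter_subset_right, hΓ.1.mono Set.inter_subset_left, fun E hE hsub hcons =>
    (hE.antisymm fun ψ hψ => ⟨?_, hsub hψ⟩).symm⟩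
  by_contra hnot
  rcases hsub hψ with hA | ⟨φ, hA, rfl⟩
  · exact hcons.not_mem_of_neg_mem (hE ⟨hΓ.neg_mem_iff.2 hnot, .inr ⟨ψ, hA, rfl⟩⟩) hψ
  · rw [hΓ.neg_mem_iff, not_not] at hnot
    exact hcons.not_mem_of_neg_mem hψ (hE ⟨hnot, .inl hA⟩)

end MaxCons

end TJL

open TJL TJL.Formula in
/-- ⊢_CS (⋀Γ̄) → ○⋁{ ⋀Δ̄ | Δ̄ ∈ X } where X = { Δ̄ ∈ MCS_χ | Γ̄ R_○ Δ̄ }.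
    The disjunction is rendered by any list `D` containing exactly the
    conjunctions of the members of X. -/
theorem deriv_next_disj_of_successors (h : ℕ) (hh : 1 ≤ h)
    (CS : Set (Formula h)) (hCS : IsConstSpec CS) (χ : Formula h)
    (Γb : Set (Formula h)) (hΓb : Γb ∈ ChiMCS CS χ)
    (γ : Formula h) (hγ : IsConj Γb γ)
    (D : List (Formula h))
    (hD1 : ∀ δ ∈ D, ∃ Δb ∈ ChiMCS CS χ, RNext CS χ Γb Δb ∧ IsConj Δb δ)
    (hD2 : ∀ Δb ∈ ChiMCS CS χ, RNext CS χ Γb Δb → ∃ δ ∈ D, IsConj Δb δ) :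
    Deriv CS (γ.imp (Formula.next (disjList D))) := by
  by_contra hnd
  have hcons : Consistent CS (insert (neg (Formula.next (disjList D))) Γb) := by
    intro hd
    obtain ⟨L, hL, hdL⟩ := hd.imp_of_insert
    obtain ⟨K, -, hK, rfl⟩ := hγ
    refine hnd (hdL.of_entails fun v hv h₁ => ?_)
    simp only [hv.imp_iff, hv.conjList_iff, hv.neg_iff, hv.bot_iff] at h₁ ⊢
    intro hv'
    exact not_not.1 (h₁ fun ψ hψ => hv' ψ ((hK ψ).2 (hL ψ hψ)))
  obtain ⟨Γ, hsub, hΓ⟩ := hcons.exists_maxCons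
  rw [Set.insert_subset_iff] at hsub
  have hΓeq : Γb = Γ ∩ SubPlus χ :=
    (hΓb.2.2 _ (Set.subset_inter hsub.2 hΓb.1) Set.inter_subset_right
      (hΓ.1.mono Set.inter_subset_left)).symm
  have hΔ := hΓ.setOf_next_mem
  obtain ⟨δ, hδD, K, -, hK, rfl⟩ := hD2 _ (hΔ.inter_subPlus_mem_chiMCS χ)
    ⟨Γ, _, hΓ, hΔ, hΓeq, rfl, fun _ hφ => hφ⟩
  have hdisj : Deriv CS ((conjList K).imp (disjList D)) := .ax (.taut _ fun v hv =>
    (hv.imp_iff _ _).2 fun h₁ => (hv.disjList_iff D).2 ⟨_, hδD, h₁⟩)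
  exact hΓ.neg_mem_iff.1 hsub.1
    (hΓ.next_mem_of_derivFrom ⟨K, fun ψ hψ => ((hK ψ).1 hψ).1, hdisj⟩)
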